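/- Let μ_{k,n−k} be the uniform probability measure on the slice X_{k,n−k} of the discrete cube. Then for all probability measures ν₁, ν₂ on X_{k,n−k}, W₁(ν₁,ν₂)² ≤ ( C_{k,n−k} / 2 ) · ( √H(ν₁|μ_{k,n−k}) + √H(ν₂|μ_{k,n−k}) )², where C_{k,n−k} = min(k, n−k) and W₁ is the Wasserstein distance for the Hamming distance d_h on X_{k,n−k}. -/

import Mathlib

attribute [local instance] Classical.propDecidable

noncomputable section

/-- The cubeSlice `X_{k, n-k}` of the discrete cube `{0,1}^n`. -/
def cubeSlice (n k : ℕ) : Set (Fin n → Bool) :=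
  {x | (Finset.univ.filter fun i => x i = true).card = k}

/-- The uniform probability measure on the cubeSlice `X_{k, n-k}`. -/
noncomputable def unifSlice (n k : ℕ) : (Fin n → Bool) → ℝ :=
  fun x => if x ∈ cubeSlice n k then ((n.choose k : ℝ))⁻¹ else 0

/-- The Hamming distance on the cubeSlice of the discrete cube. -/
noncomputable def dh {n : ℕ} (x y : Fin n → Bool) : ℝ :=
  ((Finset.univ.filter fun i => x i ≠ y i).card : ℝ) / 2

/-- Relative entropy `H(ν | μ)` of finitely supported densities; `+∞` if `ν` is not
absolutely continuous with respect to `μ`. -/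
noncomputable def relEnt {X : Type*} [Fintype X] (ν μ : X → ℝ) : ENNReal :=
  if ∀ x, μ x = 0 → ν x = 0 then
    ENNReal.ofReal (∑ x, ν x * Real.log (ν x / μ x))
  else ⊤

/-- `p` is a probability measure supported on the set `S`. -/
def IsProbOn {X : Type*} [Fintype X] (p : X → ℝ) (S : Set X) : Prop :=
  (∀ x, 0 ≤ p x) ∧ (∀ x, x ∉ S → p x = 0) ∧ ∑ x, p x = 1

/-- The `W₁` Wasserstein distance for the cost `d`. -/
noncomputable def W1 {X : Type*} [Fintype X] (d : X → X → ℝ) (ν₁ ν₂ : X → ℝ) : ℝ :=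
  sInf {w | ∃ π : X × X → ℝ,
    (∀ q, 0 ≤ π q) ∧ (∀ x, ∑ y, π (x, y) = ν₁ x) ∧ (∀ y, ∑ x, π (x, y) = ν₂ y) ∧
    w = ∑ q : X × X, d q.1 q.2 * π q}

open Finset

section Pinsker

lemma three_mul_sub_one_sq_le {t : ℝ} (ht : 0 < t) :
    3 * (t - 1) ^ 2 ≤ (2 * t + 4) * (t * Real.log t - t + 1) := by
  let g : ℝ → ℝ := fun t => Real.log t - (5 * t ^ 2 - 4 * t - 1) / (2 * t ^ 2 + 4 * t)
  have hg : ∀ x : ℝ, 0 < x → HasDerivAt g ((x - 1) ^ 3 / (x ^ 2 * (x + 2) ^ 2)) x := by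
    intro x hx
    have h1 : HasDerivAt (fun t : ℝ => 5 * t ^ 2 - 4 * t - 1) (10 * x - 4) x := by
      refine ((((hasDerivAt_pow 2 x).const_mul 5).sub
        ((hasDerivAt_id' x).const_mul 4)).sub_const 1).congr_deriv ?_
      norm_num; ring
    have h2 : HasDerivAt (fun t : ℝ => 2 * t ^ 2 + 4 * t) (4 * x + 4) x := by
      refine (((hasDerivAt_pow 2 x).const_mul 2).add
        ((hasDerivAt_id' x).const_mul 4)).congr_deriv ?_
      norm_num; ring
    have hD : 2 * x ^ 2 + 4 * x ≠ 0 := by positivity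
    refine ((Real.hasDerivAt_log hx.ne').sub (h1.div h2 hD)).congr_deriv ?_
    have : x + 2 ≠ 0 := by positivity
    have e : 2 * x ^ 2 + 4 * x = 2 * x * (x + 2) := by ring
    rw [e]
    field_simp
    ring
  have hg1 : g 1 = 0 := by simp [g]; norm_num
  have key : 0 ≤ g t := by
    rcases le_total 1 t with h | h
    · have : MonotoneOn g (Set.Ici 1) := by
        refine monotoneOn_of_deriv_nonneg (convex_Ici 1)
          (fun x hx => (hg x (by linarith [Set.mem_Ici.1 hx])).continuousAt.continuousWithinAt)
          (fun x hx => ?_) (fun x hx => ?_)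
        · rw [interior_Ici, Set.mem_Ioi] at hx
          exact (hg x (by linarith)).differentiableAt.differentiableWithinAt
        · rw [interior_Ici, Set.mem_Ioi] at hx
          rw [(hg x (by linarith)).deriv]
          have : 0 ≤ x - 1 := by linarith
          positivity
      rw [← hg1]
      exact this (Set.mem_Ici.2 le_rfl) (Set.mem_Ici.2 h) h
    · have : AntitoneOn g (Set.Ioc 0 1) := by
        refine antitoneOn_of_deriv_nonpos (convex_Ioc 0 1)
          (fun x hx => (hg x hx.1).continuousAt.continuousWithinAt)
          (fun x hx => ?_) (fun x hx => ?_)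
        · rw [interior_Ioc] at hx
          exact (hg x hx.1).differentiableAt.differentiableWithinAt
        · rw [interior_Ioc] at hx
          rw [(hg x hx.1).deriv]
          refine div_nonpos_of_nonpos_of_nonneg ?_ (by positivity)
          exact Odd.pow_nonpos (by decide) (by linarith [hx.2])
      rw [← hg1]
      exact this ⟨ht, h⟩ ⟨one_pos, le_rfl⟩ h
  have hD : 0 < 2 * t ^ 2 + 4 * t := by positivity
  have := (div_le_iff₀ hD).1 (sub_nonneg.1 key)
  nlinarith

lemma sub_sq_le_mul_log_div {p q : ℝ} (hp : 0 ≤ p) (hq : 0 ≤ q) (hpq : q = 0 → p = 0) :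
    (p - q) ^ 2 ≤ ((2 * p + 4 * q) / 3) * (p * Real.log (p / q) - p + q) := by
  rcases hq.eq_or_lt with rfl | hq
  · simp [hpq rfl]
  rcases hp.eq_or_lt with rfl | hp
  · simp; nlinarith
  have h := mul_le_mul_of_nonneg_left (three_mul_sub_one_sq_le (div_pos hp hq)) (sq_nonneg q)
  have e1 : q ^ 2 * (3 * (p / q - 1) ^ 2) = 3 * (p - q) ^ 2 := by field_simp
  have e2 : q ^ 2 * ((2 * (p / q) + 4) * (p / q * Real.log (p / q) - p / q + 1)) =
      (2 * p + 4 * q) * (p * Real.log (p / q) - p + q) := by field_simp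
  rw [e1, e2] at h
  linarith

variable {ι : Type*}

/-- **Gibbs' inequality** for finite measures of equal mass. -/
lemma sum_mul_log_div_nonneg (s : Finset ι) {p q : ι → ℝ}
    (hp : ∀ i ∈ s, 0 ≤ p i) (hq : ∀ i ∈ s, 0 ≤ q i) (hpq : ∀ i ∈ s, q i = 0 → p i = 0)
    (hmass : ∑ i ∈ s, q i = ∑ i ∈ s, p i) :
    0 ≤ ∑ i ∈ s, p i * Real.log (p i / q i) := by
  have : 0 ≤ ∑ i ∈ s, (p i * Real.log (p i / q i) - p i + q i) := by
    refine sum_nonneg fun i hi => ?_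
    rcases (hq i hi).eq_or_lt with h | h
    · simp [← h, hpq i hi h.symm]
    have h1 := sub_sq_le_mul_log_div (hp i hi) (hq i hi) (hpq i hi)
    have h2 : 0 < (2 * p i + 4 * q i) / 3 := by have := hp i hi; positivity
    exact nonneg_of_mul_nonneg_right ((sq_nonneg _).trans h1) h2
  rw [sum_add_distrib, sum_sub_distrib] at this
  linarith

/-- **Pinsker's inequality** for finite measures of equal mass. -/
lemma half_sum_abs_sub_le_sqrt (s : Finset ι) {p q : ι → ℝ}
    (hp : ∀ i ∈ s, 0 ≤ p i) (hq : ∀ i ∈ s, 0 ≤ q i) (hpq : ∀ i ∈ s, q i = 0 → p i = 0)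
    (hmass : ∑ i ∈ s, q i = ∑ i ∈ s, p i) :
    (∑ i ∈ s, |p i - q i|) / 2 ≤
      √((∑ i ∈ s, p i) / 2 * ∑ i ∈ s, p i * Real.log (p i / q i)) := by
  have h : (∑ i ∈ s, |p i - q i|) ^ 2 ≤ (∑ i ∈ s, (2 * p i + 4 * q i) / 3) *
      ∑ i ∈ s, (p i * Real.log (p i / q i) - p i + q i) := by
    refine sum_sq_le_sum_mul_sum_of_sq_le_mul s (fun i hi => ?_) (fun i hi => ?_)
      (fun i hi => ?_)
    · have := hp i hi
      have := hq i hi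
      positivity
    · rcases (hq i hi).eq_or_lt with h | h
      · simp [← h, hpq i hi h.symm]
      have h1 := sub_sq_le_mul_log_div (hp i hi) (hq i hi) (hpq i hi)
      have h2 : 0 < (2 * p i + 4 * q i) / 3 := by have := hp i hi; positivity
      exact nonneg_of_mul_nonneg_right ((sq_nonneg _).trans h1) h2
    · rw [sq_abs]
      exact sub_sq_le_mul_log_div (hp i hi) (hq i hi) (hpq i hi)
  rw [← sum_div, sum_add_distrib, sum_add_distrib, sum_sub_distrib, ← mul_sum, ← mul_sum,
    hmass] at h
  apply Real.le_sqrt_of_sq_le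
  linarith

end Pinsker

section Transport

variable {X ι : Type*} [Fintype X] {d : X → X → ℝ}

/-- Some coupling of `μ` and `ν` has `d`-cost at most `c`. -/
def TransportCostLE (d : X → X → ℝ) (μ ν : X → ℝ) (c : ℝ) : Prop :=
  ∃ π : X → X → ℝ, (∀ x y, 0 ≤ π x y) ∧ (∀ x, ∑ y, π x y = μ x) ∧
    (∀ y, ∑ x, π x y = ν y) ∧ ∑ x, ∑ y, d x y * π x y ≤ c

namespace TransportCostLE

variable {μ ν ρ : X → ℝ} {c c' : ℝ}

lemma mono (h : TransportCostLE d μ ν c) (hc : c ≤ c') : TransportCostLE d μ ν c' := by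
  obtain ⟨π, h0, h1, h2, h3⟩ := h
  exact ⟨π, h0, h1, h2, h3.trans hc⟩

lemma symm (hd : ∀ x y, d x y = d y x) (h : TransportCostLE d μ ν c) :
    TransportCostLE d ν μ c := by
  obtain ⟨π, h0, h1, h2, h3⟩ := h
  refine ⟨fun x y => π y x, fun x y => h0 y x, h2, h1, ?_⟩
  rw [sum_comm]
  simpa only [hd] using h3

lemma map_equiv (hμ : ∀ x, 0 ≤ μ x) (σ : X ≃ X) (hσ : ∀ x, ν (σ x) = μ x) :
    TransportCostLE d μ ν (∑ x, μ x * d x (σ x)) := by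
  refine ⟨fun x y => if y = σ x then μ x else 0, fun x y => ?_, fun x => ?_, fun y => ?_, ?_⟩
  · dsimp only
    split_ifs
    exacts [hμ x, le_rfl]
  · simp
  · obtain ⟨x, rfl⟩ := σ.surjective y
    simp [hσ]
  · refine le_of_eq (sum_congr rfl fun x _ => ?_)
    simp [mul_comm]

lemma rfl_of_nonneg (hd : ∀ x, d x x = 0) (hμ : ∀ x, 0 ≤ μ x) : TransportCostLE d μ μ 0 := by
  simpa [hd] using map_equiv (d := d) hμ (Equiv.refl X) (fun _ => rfl)

lemma smul (h : TransportCostLE d μ ν c) {r : ℝ} (hr : 0 ≤ r) :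
    TransportCostLE d (fun x => r * μ x) (fun x => r * ν x) (r * c) := by
  obtain ⟨π, h0, h1, h2, h3⟩ := h
  refine ⟨fun x y => r * π x y, fun x y => mul_nonneg hr (h0 x y), fun x => ?_, fun y => ?_, ?_⟩
  · rw [← mul_sum, h1]
  · rw [← mul_sum, h2]
  · refine le_trans (le_of_eq ?_) (mul_le_mul_of_nonneg_left h3 hr)
    simp_rw [mul_sum]
    exact sum_congr rfl fun x _ => sum_congr rfl fun y _ => by ring

lemma sum (s : Finset ι) {μ ν : ι → X → ℝ} {c : ι → ℝ}
    (h : ∀ i ∈ s, TransportCostLE d (μ i) (ν i) (c i)) :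
    TransportCostLE d (fun x => ∑ i ∈ s, μ i x) (fun x => ∑ i ∈ s, ν i x) (∑ i ∈ s, c i) := by
  choose! π h0 h1 h2 h3 using h
  refine ⟨fun x y => ∑ i ∈ s, π i x y, fun x y => sum_nonneg fun i hi => h0 i hi x y,
    fun x => ?_, fun y => ?_, ?_⟩
  · rw [sum_comm]
    exact sum_congr rfl fun i hi => h1 i hi x
  · rw [sum_comm]
    exact sum_congr rfl fun i hi => h2 i hi y
  · refine le_trans (le_of_eq ?_) (sum_le_sum h3)
    simp_rw [mul_sum]
    exact (sum_congr rfl fun x _ => sum_comm).trans sum_comm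

lemma add {μ' ν' : X → ℝ} (h : TransportCostLE d μ ν c) (h' : TransportCostLE d μ' ν' c') :
    TransportCostLE d (fun x => μ x + μ' x) (fun x => ν x + ν' x) (c + c') := by
  have := sum (d := d) (univ : Finset Bool) (μ := fun i => cond i μ μ')
    (ν := fun i => cond i ν ν') (c := fun i => cond i c c') (by rintro (_ | _) - <;> assumption)
  simpa using this

lemma trans (hd : ∀ x y z, d x z ≤ d x y + d y z)
    (h : TransportCostLE d μ ν c) (h' : TransportCostLE d ν ρ c') :
    TransportCostLE d μ ρ (c + c') := by
  obtain ⟨π, h0, h1, h2, h3⟩ := h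
  obtain ⟨π', h0', h1', h2', h3'⟩ := h'
  have hν : ∀ y, 0 ≤ ν y := fun y => h2 y ▸ sum_nonneg fun x _ => h0 x y
  have hz : ∀ x y, ν y = 0 → π x y = 0 := fun x y hy =>
    (sum_eq_zero_iff_of_nonneg fun x _ => h0 x y).1 ((h2 y).trans hy) x (mem_univ x)
  have hz' : ∀ y z, ν y = 0 → π' y z = 0 := fun y z hy =>
    (sum_eq_zero_iff_of_nonneg fun z _ => h0' y z).1 ((h1' y).trans hy) z (mem_univ z)
  have e1 : ∀ x y, ∑ z, π x y * π' y z / ν y = π x y := fun x y => by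
    rw [← sum_div, ← mul_sum, h1']
    by_cases hy : ν y = 0
    · simp [hy, hz x y hy]
    · field_simp
  have e2 : ∀ y z, ∑ x, π x y * π' y z / ν y = π' y z := fun y z => by
    rw [← sum_div, ← sum_mul, h2]
    by_cases hy : ν y = 0
    · simp [hy, hz' y z hy]
    · field_simp
  refine ⟨fun x z => ∑ y, π x y * π' y z / ν y, fun x z => sum_nonneg fun y _ =>
    div_nonneg (mul_nonneg (h0 x y) (h0' y z)) (hν y), fun x => ?_, fun z => ?_, ?_⟩
  · rw [sum_comm]
    simp_rw [e1, h1]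
  · rw [sum_comm]
    simp_rw [e2, h2']
  · calc ∑ x, ∑ z, d x z * ∑ y, π x y * π' y z / ν y
        ≤ ∑ x, ∑ z, ∑ y, (d x y * (π x y * π' y z / ν y) + d y z * (π x y * π' y z / ν y)) := by
          refine sum_le_sum fun x _ => sum_le_sum fun z _ => ?_
          rw [mul_sum]
          refine sum_le_sum fun y _ => ?_
          rw [← add_mul]
          exact mul_le_mul_of_nonneg_right (hd x y z)
            (div_nonneg (mul_nonneg (h0 x y) (h0' y z)) (hν y))
      _ = ∑ x, ∑ y, d x y * π x y + ∑ y, ∑ z, d y z * π' y z := by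
          simp_rw [sum_add_distrib]
          congr 1
          · refine sum_congr rfl fun x _ => ?_
            rw [sum_comm]
            simp_rw [← mul_sum, e1]
          · rw [sum_comm, sum_congr rfl fun z _ => sum_comm, sum_comm]
            simp_rw [← mul_sum, e2]
      _ ≤ c + c' := add_le_add h3 h3'

/-- Two mixtures of the same family are as close as their weights are in total variation. -/
lemma mixture (hd : ∀ x, d x x = 0) (s : Finset ι) {ρ : ι → X → ℝ} {p q : ι → ℝ} {D : ℝ}
    (hρ : ∀ i ∈ s, ∀ x, 0 ≤ ρ i x) (hp : ∀ i ∈ s, 0 ≤ p i) (hq : ∀ i ∈ s, 0 ≤ q i)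
    (hmass : ∑ i ∈ s, q i = ∑ i ∈ s, p i)
    (hD : ∀ i ∈ s, ∀ j ∈ s, TransportCostLE d (ρ i) (ρ j) D) :
    TransportCostLE d (fun x => ∑ i ∈ s, p i * ρ i x) (fun x => ∑ i ∈ s, q i * ρ i x)
      ((∑ i ∈ s, |p i - q i|) / 2 * D) := by
  let e : ι → ℝ := fun i => max (p i - q i) 0
  let e' : ι → ℝ := fun i => max (q i - p i) 0
  have he : ∀ i, 0 ≤ e i := fun i => le_max_right _ _
  have he' : ∀ i, 0 ≤ e' i := fun i => le_max_right _ _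
  have hpe : ∀ i, min (p i) (q i) + e i = p i := fun i => by
    simp only [e]
    rcases le_total (p i) (q i) with h | h <;> simp [h]
  have hqe : ∀ i, min (p i) (q i) + e' i = q i := fun i => by
    simp only [e']
    rcases le_total (p i) (q i) with h | h <;> simp [h]
  have habs : ∀ i, |p i - q i| = e i + e' i := fun i => by
    simp only [e, e']
    rcases le_total (p i) (q i) with h | h
    · rw [abs_of_nonpos (by linarith), max_eq_right (by linarith), max_eq_left (by linarith)]
      ring
    · rw [abs_of_nonneg (by linarith), max_eq_left (by linarith), max_eq_right (by linarith)]
      ring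
  set T := ∑ i ∈ s, e i with hT
  have hT' : ∑ i ∈ s, e' i = T := by
    have h1 := sum_congr rfl fun i (_ : i ∈ s) => hpe i
    have h2 := sum_congr rfl fun i (_ : i ∈ s) => hqe i
    rw [sum_add_distrib] at h1 h2
    linarith
  have hT0 : 0 ≤ T := sum_nonneg fun i _ => he i
  have hc : (∑ i ∈ s, |p i - q i|) / 2 * D = 0 + ∑ i ∈ s, ∑ j ∈ s, e i * e' j / T * D := by
    simp_rw [habs, sum_add_distrib, ← sum_mul, ← sum_div, ← mul_sum, ← sum_mul, hT', ← hT]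
    by_cases h : T = 0
    · simp [h]
    · field_simp; ring
  have hleft : ∀ i ∈ s, ∑ j ∈ s, e i * e' j / T = e i := fun i hi => by
    rw [← sum_div, ← mul_sum, hT']
    by_cases h : T = 0
    · simp [h, (sum_eq_zero_iff_of_nonneg fun i _ => he i).1 h i hi]
    · field_simp
  have hright : ∀ j ∈ s, ∑ i ∈ s, e i * e' j / T = e' j := fun j hj => by
    rw [← sum_div, ← sum_mul, ← hT]
    by_cases h : T = 0
    · simp [h, (sum_eq_zero_iff_of_nonneg fun i _ => he' i).1 (hT'.trans h) j hj]
    · field_simp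
  have h1 : TransportCostLE d (fun x => ∑ i ∈ s, min (p i) (q i) * ρ i x)
      (fun x => ∑ i ∈ s, min (p i) (q i) * ρ i x) 0 :=
    rfl_of_nonneg hd fun x => sum_nonneg fun i hi =>
      mul_nonneg (le_min (hp i hi) (hq i hi)) (hρ i hi x)
  have h2 := sum (d := d) s fun i hi => sum (d := d) s fun j hj =>
    (hD i hi j hj).smul (div_nonneg (mul_nonneg (he i) (he' j)) hT0)
  rw [hc]
  convert h1.add h2 using 1
  · funext x
    rw [← sum_add_distrib]
    refine sum_congr rfl fun i hi => ?_
    rw [← sum_mul, hleft i hi, ← add_mul, hpe]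
  · funext x
    rw [sum_comm, ← sum_add_distrib]
    refine sum_congr rfl fun i hi => ?_
    rw [← sum_mul, hright i hi, ← add_mul, hqe]

lemma W1_le (hd : ∀ x y, 0 ≤ d x y) (h : TransportCostLE d μ ν c) : W1 d μ ν ≤ c := by
  obtain ⟨π, h0, h1, h2, h3⟩ := h
  refine le_trans (csInf_le ⟨0, ?_⟩ ⟨fun q => π q.1 q.2, fun q => h0 _ _, h1, h2, rfl⟩) ?_
  · rintro w ⟨π, h0, -, -, rfl⟩
    exact sum_nonneg fun q _ => mul_nonneg (hd _ _) (h0 q)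
  · rwa [Fintype.sum_prod_type]

end TransportCostLE

lemma W1_nonneg (hd : ∀ x y, 0 ≤ d x y) (μ ν : X → ℝ) : 0 ≤ W1 d μ ν := by
  refine Real.sInf_nonneg ?_
  rintro w ⟨π, h0, -, -, rfl⟩
  exact sum_nonneg fun q _ => mul_nonneg (hd _ _) (h0 q)

end Transport

section Slice

variable {n : ℕ}

lemma dh_nonneg (x y : Fin n → Bool) : 0 ≤ dh x y := by
  unfold dh
  positivity

lemma dh_self (x : Fin n → Bool) : dh x x = 0 := by
  simp [dh]

lemma dh_comm (x y : Fin n → Bool) : dh x y = dh y x := by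
  simp only [dh, ne_comm]

lemma dh_triangle (x y z : Fin n → Bool) : dh x z ≤ dh x y + dh y z := by
  have h : #{i | x i ≠ z i} ≤ #{i | x i ≠ y i} + #{i | y i ≠ z i} := by
    refine le_trans (card_le_card fun i hi => ?_) (card_union_le _ _)
    simp only [mem_union, mem_filter, mem_univ, true_and] at hi ⊢
    by_contra! h
    exact hi (h.1.trans h.2)
  have h' : (#{i | x i ≠ z i} : ℝ) ≤ #{i | x i ≠ y i} + #{i | y i ≠ z i} := by exact_mod_cast h
  simp only [dh]
  linarith

lemma dh_comp_swap_le (x : Fin n → Bool) (a c : Fin n) : dh x (x ∘ Equiv.swap a c) ≤ 1 := by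
  have h : #{i | x i ≠ (x ∘ Equiv.swap a c) i} ≤ 2 := by
    refine le_trans (card_le_card (t := {a, c}) fun i hi => ?_) card_le_two
    simp only [mem_filter, mem_univ, true_and, Function.comp_apply] at hi
    by_contra h
    simp only [mem_insert, mem_singleton, not_or] at h
    exact hi (by rw [Equiv.swap_apply_of_ne_of_ne h.1 h.2])
  have h' : (#{i | x i ≠ (x ∘ Equiv.swap a c) i} : ℝ) ≤ 2 := by exact_mod_cast h
  simp only [dh]
  linarith

/-- The points taking the value `b` exactly `k` times, and everywhere on `S`. -/
def IsSubslice (b : Bool) (k : ℕ) (S : Finset (Fin n)) (x : Fin n → Bool) : Prop :=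
  #{i | x i = b} = k ∧ ∀ i ∈ S, x i = b

/-- The uniform probability density on the points satisfying `IsSubslice b k S`. -/
def unifSubslice (b : Bool) (k : ℕ) (S : Finset (Fin n)) (x : Fin n → Bool) : ℝ :=
  if IsSubslice b k S x then ((n - #S).choose (k - #S) : ℝ)⁻¹ else 0

variable {b : Bool} {k m : ℕ} {S : Finset (Fin n)} {x : Fin n → Bool}

lemma unifSubslice_nonneg : 0 ≤ unifSubslice b k S x := by
  unfold unifSubslice
  split_ifs <;> positivity

lemma unifSubslice_pos (hk : k ≤ n) (h : IsSubslice b k S x) : 0 < unifSubslice b k S x := by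
  rw [unifSubslice, if_pos h]
  have := Nat.choose_pos (Nat.sub_le_sub_right hk #S)
  positivity

lemma isSubslice_insert {a : Fin n} :
    IsSubslice b k (insert a S) x ↔ IsSubslice b k S x ∧ x a = b := by
  simp only [IsSubslice, forall_mem_insert]
  tauto

lemma isSubslice_comp_swap {a c : Fin n} (ha : a ∉ S) (hc : c ∉ S) :
    IsSubslice b k (insert c S) (x ∘ Equiv.swap a c) ↔ IsSubslice b k (insert a S) x := by
  have h1 : #{i | (x ∘ Equiv.swap a c) i = b} = #{i | x i = b} :=
    card_equiv (Equiv.swap a c) (by simp)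
  have h2 : (∀ i ∈ S, (x ∘ Equiv.swap a c) i = b) ↔ ∀ i ∈ S, x i = b := by
    refine forall₂_congr fun i hi => ?_
    rw [Function.comp_apply, Equiv.swap_apply_of_ne_of_ne (by rintro rfl; exact ha hi)
      (by rintro rfl; exact hc hi)]
  rw [isSubslice_insert, isSubslice_insert, IsSubslice, IsSubslice, h1, h2, Function.comp_apply,
    Equiv.swap_apply_right]

lemma transportCostLE_unifSubslice_insert {a c : Fin n} (ha : a ∉ S) (hc : c ∉ S)
    (hmass : ∑ x, unifSubslice b k (insert a S) x = 1) :
    TransportCostLE dh (unifSubslice b k (insert a S)) (unifSubslice b k (insert c S)) 1 := by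
  have h := TransportCostLE.map_equiv (d := dh) (μ := unifSubslice b k (insert a S))
    (ν := unifSubslice b k (insert c S)) (fun _ => unifSubslice_nonneg)
    ((Equiv.swap a c).arrowCongr (Equiv.refl Bool)) fun x => by
      have : (Equiv.swap a c).arrowCongr (Equiv.refl Bool) x = x ∘ Equiv.swap a c := by
        ext i; simp [Equiv.arrowCongr]
      rw [this]
      simp only [unifSubslice, isSubslice_comp_swap ha hc, card_insert_of_notMem ha,
        card_insert_of_notMem hc]
  refine h.mono ?_
  rw [← hmass]
  refine sum_le_sum fun x _ => mul_le_of_le_one_right unifSubslice_nonneg ?_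
  have : (Equiv.swap a c).arrowCongr (Equiv.refl Bool) x = x ∘ Equiv.swap a c := by
    ext i; simp [Equiv.arrowCongr]
  rw [this]
  exact dh_comp_swap_le x a c

lemma IsSubslice.card_filter_compl (h : IsSubslice b k S x) (hS : #S + (m + 1) = k) :
    #{a ∈ Sᶜ | x a = b} = m + 1 := by
  have e : ({a ∈ Sᶜ | x a = b} : Finset (Fin n)) = ({a | x a = b} : Finset (Fin n)) \ S := by
    ext; simp [and_comm]
  rw [e, card_sdiff_of_subset fun i hi => by simpa using h.2 i hi, h.1]
  omega

lemma sum_compl_ite_div (w : (Fin n → Bool) → ℝ) (hw : ∀ x, ¬ IsSubslice b k S x → w x = 0)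
    (hS : #S + (m + 1) = k) (x : Fin n → Bool) :
    ∑ a ∈ Sᶜ, (if x a = b then w x / (m + 1) else 0) = w x := by
  by_cases h : IsSubslice b k S x
  · rw [← sum_filter, sum_const, h.card_filter_compl hS, nsmul_eq_mul]
    push_cast
    field_simp
  · simp [hw x h]

lemma unifSubslice_insert (hk : k ≤ n) (hS : #S + (m + 1) = k) {a : Fin n} (ha : a ∉ S) :
    unifSubslice b k (insert a S) x =
      if x a = b then (n - #S : ℝ) * (unifSubslice b k S x / (m + 1)) else 0 := by
  obtain ⟨r, hr⟩ : ∃ r, n = #S + (r + 1) := ⟨n - #S - 1, by omega⟩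
  have hmr : m ≤ r := by omega
  simp only [unifSubslice, isSubslice_insert, card_insert_of_notMem ha]
  by_cases hx : IsSubslice b k S x <;> by_cases hxa : x a = b <;> simp only [hx, hxa, and_true,
    and_false, if_true, if_false, zero_div, mul_zero]
  have e1 : n - (#S + 1) = r := by omega
  have e2 : n - #S = r + 1 := by omega
  have e3 : k - (#S + 1) = m := by omega
  have e4 : k - #S = m + 1 := by omega
  have e5 : (n : ℝ) - #S = r + 1 := by
    rw [sub_eq_iff_eq_add, add_comm]
    exact_mod_cast hr
  rw [e1, e2, e3, e4, e5]
  have key : ((r : ℝ) + 1) * r.choose m = (r + 1).choose (m + 1) * (m + 1) := by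
    exact_mod_cast Nat.add_one_mul_choose_eq r m
  have p1 : (0 : ℝ) < r.choose m := by exact_mod_cast Nat.choose_pos hmr
  have p2 : (0 : ℝ) < (r + 1).choose (m + 1) := by
    exact_mod_cast Nat.choose_pos (Nat.succ_le_succ hmr)
  field_simp
  linarith

lemma isSubslice_iff_eq_of_card_eq (hS : #S = k) :
    IsSubslice b k S x ↔ x = fun i => if i ∈ S then b else !b := by
  constructor
  · rintro ⟨h1, h2⟩
    have e : S = ({i | x i = b} : Finset (Fin n)) :=
      eq_of_subset_of_card_le (fun i hi => by simpa using h2 i hi) (by rw [h1, hS])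
    funext i
    split_ifs with hi
    · exact h2 i hi
    · rw [e] at hi
      simpa [Bool.eq_not] using hi
  · rintro rfl
    refine ⟨?_, fun i hi => by simp [hi]⟩
    rw [← hS]
    congr 1
    ext i
    by_cases hi : i ∈ S <;> simp [hi]

lemma sqrt_mul_add_sqrt_le {s u v : ℝ} (hs : 0 ≤ s) (hu : 0 ≤ u) (hv : 0 ≤ v) :
    √(s * u) + √v ≤ √((s + 1) * (u + v)) := by
  apply Real.le_sqrt_of_sq_le
  rw [Real.sqrt_mul hs]
  nlinarith [sq_nonneg (√u - √s * √v), Real.sq_sqrt hs, Real.sq_sqrt hu, Real.sq_sqrt hv]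

lemma sum_sqrt_mul_le {ι : Type*} (s : Finset ι) {f g : ι → ℝ} (hf : ∀ i ∈ s, 0 ≤ f i)
    (hg : ∀ i ∈ s, 0 ≤ g i) : ∑ i ∈ s, √(f i * g i) ≤ √((∑ i ∈ s, f i) * ∑ i ∈ s, g i) :=
  Real.le_sqrt_of_sq_le <| sum_sq_le_sum_mul_sum_of_sq_le_mul s hf hg fun i hi =>
    (Real.sq_sqrt (mul_nonneg (hf i hi) (hg i hi))).le

theorem transportCostLE_unifSubslice (hk : k ≤ n) (m : ℕ) (S : Finset (Fin n))
    (hS : #S + m = k) :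
    ∑ x, unifSubslice b k S x = 1 ∧
    ∀ ν : (Fin n → Bool) → ℝ, (∀ x, 0 ≤ ν x) → (∀ x, ¬ IsSubslice b k S x → ν x = 0) →
      TransportCostLE dh ν (fun x => (∑ y, ν y) * unifSubslice b k S x)
        √(m / 2 * ((∑ y, ν y) *
          ∑ x, ν x * Real.log (ν x / ((∑ y, ν y) * unifSubslice b k S x)))) := by
  induction m generalizing S with
  | zero =>
    have hSk : #S = k := by simpa using hS
    have hμ : ∀ x, unifSubslice b k S x = if x = (fun i => if i ∈ S then b else !b) then 1 else 0 :=
      fun x => by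
        unfold unifSubslice
        simp [isSubslice_iff_eq_of_card_eq hSk, hSk]
    refine ⟨by simp [hμ], fun ν hν hν' => ?_⟩
    have h0 : ∀ x, x ≠ (fun i => if i ∈ S then b else !b) → ν x = 0 := fun x hx =>
      hν' x (by rwa [isSubslice_iff_eq_of_card_eq hSk])
    have hsum : ∑ y, ν y = ν (fun i => if i ∈ S then b else !b) :=
      sum_eq_single _ (fun x _ hx => h0 x hx) (by simp)
    have e : (fun x => (∑ y, ν y) * unifSubslice b k S x) = ν := by
      funext x
      rw [hμ, hsum]
      split_ifs with h
      · rw [h, mul_one]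
      · rw [h0 x h, mul_zero]
    rw [e]
    simpa using TransportCostLE.rfl_of_nonneg dh_self hν
  | succ m ih =>
    have hcard : ∀ a ∈ Sᶜ, #(insert a S) + m = k := fun a ha => by
      rw [card_insert_of_notMem (mem_compl.1 ha)]; omega
    have hr : (0 : ℝ) < n - #S := by
      have : #S < n := by omega
      rw [sub_pos]
      exact_mod_cast this
    have hcompl : (#Sᶜ : ℝ) = n - #S := by
      rw [card_compl, Fintype.card_fin, Nat.cast_sub (by omega)]
    have hμsupp : ∀ x, ¬ IsSubslice b k S x → unifSubslice b k S x = 0 := fun x hx => by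
      simp [unifSubslice, hx]
    have hμdec : ∀ x, ∑ a ∈ Sᶜ, (n - #S : ℝ)⁻¹ * unifSubslice b k (insert a S) x =
        unifSubslice b k S x := fun x => by
      rw [← sum_compl_ite_div (unifSubslice b k S) hμsupp hS x]
      refine sum_congr rfl fun a ha => ?_
      rw [unifSubslice_insert hk hS (mem_compl.1 ha)]
      split_ifs
      · field_simp
      · simp
    have hmass : ∑ x, unifSubslice b k S x = 1 := by
      simp_rw [← hμdec]
      rw [sum_comm]
      simp_rw [← mul_sum]
      rw [sum_congr rfl fun a ha => (ih _ (hcard a ha)).1, sum_const, nsmul_eq_mul, hcompl,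
        mul_one, inv_mul_cancel₀ hr.ne']
    refine ⟨hmass, fun ν hν hν' => ?_⟩
    set M := ∑ y, ν y with hM
    let νa : Fin n → (Fin n → Bool) → ℝ := fun a x => if x a = b then ν x / (m + 1) else 0
    let p : Fin n → ℝ := fun a => ∑ x, νa a x
    have hνa : ∀ a x, 0 ≤ νa a x := fun a x => by
      have := hν x
      simp only [νa]
      split_ifs <;> positivity
    have hp : ∀ a, 0 ≤ p a := fun a => sum_nonneg fun x _ => hνa a x
    have hνdec : ∀ x, ∑ a ∈ Sᶜ, νa a x = ν x := sum_compl_ite_div ν hν' hS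
    have hpM : ∑ a ∈ Sᶜ, p a = M := by
      simp only [p]
      rw [sum_comm]
      simp_rw [hνdec, hM]
    have hM0 : 0 ≤ M := sum_nonneg fun x _ => hν x
    have hνsupp : ∀ a x, ¬ IsSubslice b k (insert a S) x → νa a x = 0 := fun a x hx => by
      rw [isSubslice_insert, not_and] at hx
      by_cases h : IsSubslice b k S x
      · simp [νa, hx h]
      · simp [νa, hν' x h]
    let h : Fin n → ℝ := fun a =>
      ∑ x, νa a x * Real.log (νa a x / (p a * unifSubslice b k (insert a S) x))
    have hp_zero : ∀ a, p a = 0 → ∀ x, νa a x = 0 := fun a ha x =>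
      (sum_eq_zero_iff_of_nonneg fun x _ => hνa a x).1 ha x (mem_univ x)
    have hh : ∀ a ∈ Sᶜ, 0 ≤ h a := fun a ha => by
      refine sum_mul_log_div_nonneg univ (fun x _ => hνa a x)
        (fun x _ => mul_nonneg (hp a) unifSubslice_nonneg) (fun x _ hx => ?_) ?_
      · by_cases hx' : IsSubslice b k (insert a S) x
        · rcases mul_eq_zero.1 hx with h | h
          · exact hp_zero a h x
          · exact absurd h (unifSubslice_pos hk hx').ne'
        · exact hνsupp a x hx'
      · rw [← mul_sum, (ih _ (hcard a ha)).1, mul_one]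
    have hM_zero : M = 0 → ∀ a ∈ Sᶜ, p a = 0 := fun h0 a ha =>
      (sum_eq_zero_iff_of_nonneg fun a _ => hp a).1 (hpM.trans h0) a ha
    have hqM : ∑ a ∈ Sᶜ, M * (n - #S : ℝ)⁻¹ = ∑ a ∈ Sᶜ, p a := by
      rw [sum_const, nsmul_eq_mul, hcompl, hpM]
      field_simp
    have hq0 : ∀ a ∈ Sᶜ, 0 ≤ M * (n - #S : ℝ)⁻¹ := fun a _ => by positivity
    have hqp : ∀ a ∈ Sᶜ, M * (n - #S : ℝ)⁻¹ = 0 → p a = 0 := fun a ha h0 =>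
      hM_zero ((mul_eq_zero.1 h0).resolve_right (inv_ne_zero hr.ne')) a ha
    have hchain : ∑ a ∈ Sᶜ, h a + ∑ a ∈ Sᶜ, p a * Real.log (p a / (M * (n - #S : ℝ)⁻¹)) =
        ∑ x, ν x * Real.log (ν x / (M * unifSubslice b k S x)) := by
      rw [← sum_add_distrib]
      calc _ = ∑ a ∈ Sᶜ, ∑ x, νa a x * Real.log (ν x / (M * unifSubslice b k S x)) := by
            refine sum_congr rfl fun a ha => ?_
            simp only [h]
            rw [show p a = ∑ x, νa a x from rfl, sum_mul, ← sum_add_distrib]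
            refine sum_congr rfl fun x _ => ?_
            rw [← mul_add]
            rcases (hνa a x).eq_or_lt with h0 | h0
            · simp [← h0]
            congr 1
            have hpa : 0 < p a := (hp a).lt_of_ne fun h1 => h0.ne' (hp_zero a h1.symm x)
            have hMpos : 0 < M := hM0.lt_of_ne fun h1 => hpa.ne' (hM_zero h1.symm a ha)
            have hsl : IsSubslice b k (insert a S) x := by
              by_contra hx
              exact h0.ne' (hνsupp a x hx)
            have hxa := (isSubslice_insert.1 hsl).2
            have hμ := unifSubslice_pos hk (isSubslice_insert.1 hsl).1
            have hνx : νa a x = ν x / (m + 1) := by simp [νa, hxa]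
            have hνpos : 0 < ν x := by
              rw [hνx] at h0
              exact (div_pos_iff_of_pos_right (by positivity)).1 h0
            change Real.log (νa a x / (p a * _)) + Real.log (p a / _) = _
            rw [hνx, unifSubslice_insert hk hS (mem_compl.1 ha), if_pos hxa,
              ← Real.log_mul (by positivity) (by positivity)]
            congr 1
            field_simp
        _ = _ := by
            rw [sum_comm]
            simp_rw [← sum_mul, hνdec]
    have hH1 : 0 ≤ ∑ a ∈ Sᶜ, p a * Real.log (p a / (M * (n - #S : ℝ)⁻¹)) :=
      sum_mul_log_div_nonneg _ (fun a _ => hp a) hq0 hqp hqM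
    have t1 := TransportCostLE.sum Sᶜ fun a ha =>
      (ih _ (hcard a ha)).2 (νa a) (hνa a) (hνsupp a)
    have t2 := TransportCostLE.mixture dh_self Sᶜ (ρ := fun a => unifSubslice b k (insert a S))
      (D := 1) (fun _ _ _ => unifSubslice_nonneg) (fun a _ => hp a) hq0 hqM
      fun a ha c hc => transportCostLE_unifSubslice_insert (mem_compl.1 ha) (mem_compl.1 hc)
        (ih _ (hcard a ha)).1
    have t := t1.trans dh_triangle t2
    have e : ∀ x, ∑ a ∈ Sᶜ, M * (n - #S : ℝ)⁻¹ * unifSubslice b k (insert a S) x =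
        M * unifSubslice b k S x := fun x => by
      rw [← hμdec, mul_sum]
      exact sum_congr rfl fun a _ => mul_assoc _ _ _
    simp_rw [hνdec, e] at t
    refine t.mono ?_
    have c1 : ∑ a ∈ Sᶜ, √(m / 2 * (p a * h a)) ≤ √(m * (M / 2 * ∑ a ∈ Sᶜ, h a)) := by
      have := sum_sqrt_mul_le Sᶜ (f := fun a => m / 2 * p a) (g := h)
        (fun a _ => mul_nonneg (by positivity) (hp a)) hh
      rw [← mul_sum, hpM] at this
      refine le_trans (le_of_eq ?_) (this.trans (le_of_eq ?_))
      · simp_rw [mul_assoc]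
      · congr 1; ring
    have c2 := half_sum_abs_sub_le_sqrt Sᶜ (fun a _ => hp a) hq0 hqp hqM
    rw [hpM] at c2
    have c3 := sqrt_mul_add_sqrt_le (Nat.cast_nonneg m)
      (mul_nonneg (div_nonneg hM0 two_pos.le) (sum_nonneg hh)) (mul_nonneg (div_nonneg hM0 two_pos.le) hH1)
    rw [mul_one]
    refine (add_le_add c1 c2).trans (c3.trans (le_of_eq ?_))
    rw [← mul_add, hchain]
    congr 1
    push_cast
    ring

lemma isSubslice_true_empty : IsSubslice true k ∅ x ↔ x ∈ cubeSlice n k := by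
  simp [IsSubslice, cubeSlice]

lemma isSubslice_false_empty (hk : k ≤ n) :
    IsSubslice false (n - k) ∅ x ↔ x ∈ cubeSlice n k := by
  have h := card_filter_add_card_filter_not (s := (univ : Finset (Fin n))) (fun i => x i = true)
  simp only [Bool.not_eq_true, card_univ, Fintype.card_fin] at h
  simp only [IsSubslice, cubeSlice, Set.mem_ofPred_eq, notMem_empty, IsEmpty.forall_iff,
    implies_true, and_true]
  omega

/-- The relative entropy of a probability measure on the slice, as a real number. -/
def realEnt (n k : ℕ) (ν : (Fin n → Bool) → ℝ) : ℝ :=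
  ∑ x, ν x * Real.log (ν x / unifSlice n k x)

lemma transportCostLE_unifSlice (hk : k ≤ n) {ν : (Fin n → Bool) → ℝ}
    (hν : IsProbOn ν (cubeSlice n k)) :
    TransportCostLE dh ν (unifSlice n k) √((min k (n - k) : ℕ) / 2 * realEnt n k ν) := by
  obtain ⟨h0, hsupp, hsum⟩ := hν
  rcases min_choice k (n - k) with h | h
  · have e : unifSubslice true k ∅ = unifSlice n k := by
      funext x
      simp [unifSubslice, unifSlice, isSubslice_true_empty]
    have := (transportCostLE_unifSubslice (b := true) hk k ∅ (by simp)).2 ν h0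
      fun x hx => hsupp x (by rwa [isSubslice_true_empty] at hx)
    simpa only [hsum, one_mul, e, h, realEnt] using this
  · have e : unifSubslice false (n - k) ∅ = unifSlice n k := by
      funext x
      simp [unifSubslice, unifSlice, isSubslice_false_empty hk, Nat.choose_symm hk]
    have := (transportCostLE_unifSubslice (b := false) (n.sub_le k) (n - k) ∅ (by simp)).2 ν h0
      fun x hx => hsupp x (by rwa [isSubslice_false_empty hk] at hx)
    simpa only [hsum, one_mul, e, h, realEnt] using this

lemma relEnt_unifSlice (hk : k ≤ n) {ν : (Fin n → Bool) → ℝ}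
    (hν : IsProbOn ν (cubeSlice n k)) :
    relEnt ν (unifSlice n k) = ENNReal.ofReal (realEnt n k ν) := by
  refine if_pos fun x hx => hν.2.1 x fun hmem => ?_
  have := (Nat.choose_pos hk).ne'
  simp [unifSlice, hmem, this] at hx

end Slice

/-- Transport-entropy inequality for `W₁` on the cubeSlice of the discrete cube. -/
theorem stmt10 {n k : ℕ} (hn : 1 ≤ n) (hk : k ≤ n)
    (ν₁ ν₂ : (Fin n → Bool) → ℝ)
    (hν₁ : IsProbOn ν₁ (cubeSlice n k)) (hν₂ : IsProbOn ν₂ (cubeSlice n k)) :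
    ENNReal.ofReal (W1 dh ν₁ ν₂ ^ 2) ≤
      ENNReal.ofReal (((min k (n - k) : ℕ) : ℝ) / 2) *
        (relEnt ν₁ (unifSlice n k) ^ ((1 : ℝ) / 2) +
          relEnt ν₂ (unifSlice n k) ^ ((1 : ℝ) / 2)) ^ 2 := by
  have h1 := transportCostLE_unifSlice hk hν₁
  have h2 := transportCostLE_unifSlice hk hν₂
  set C : ℝ := ((min k (n - k) : ℕ) : ℝ) / 2
  have hC : 0 ≤ C := by positivity
  have hW := (h1.trans dh_triangle (h2.symm dh_comm)).W1_le dh_nonneg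
  rw [Real.sqrt_mul hC, Real.sqrt_mul hC, ← mul_add] at hW
  have hsqrt : ∀ r : ℝ, ENNReal.ofReal r ^ ((1 : ℝ) / 2) = ENNReal.ofReal √r := fun r => by
    rcases le_total 0 r with hr | hr
    · rw [ENNReal.ofReal_rpow_of_nonneg hr (by norm_num), Real.sqrt_eq_rpow]
    · simp [ENNReal.ofReal_of_nonpos hr, Real.sqrt_eq_zero_of_nonpos hr]
  rw [relEnt_unifSlice hk hν₁, relEnt_unifSlice hk hν₂, hsqrt, hsqrt,
    ← ENNReal.ofReal_add (Real.sqrt_nonneg _) (Real.sqrt_nonneg _),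
    ← ENNReal.ofReal_pow (by positivity), ← ENNReal.ofReal_mul hC]
  refine ENNReal.ofReal_le_ofReal
    ((pow_le_pow_left₀ (W1_nonneg dh_nonneg _ _) hW 2).trans (le_of_eq ?_))
  rw [mul_pow, Real.sq_sqrt hC]

end
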